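/- arXiv:1709.01420 — 2 statements merged into one kernel-verified Lean document; each statement's English description precedes it below -/
import Mathlib

section
/- Let S be a finite subset of a real normed vector space V, let C be the convex hull of S over ℝ, let p ∈ (0,1], and let x ∈ V with x ∉ C. Then there exists d ∈ S such that p • x + (1-p) • d ∉ C. -/
/-- If `C` is the convex hull of a finite set `S`, `p ∈ (0,1]`, and `x ∉ C`,
then there is a point `d ∈ S` with `p • x + (1-p) • d ∉ C`. -/
theorem exists_vertex_mix_not_mem_convexHull
    {V : Type*} [NormedAddCommGroup V] [NormedSpace ℝ V]
    (S : Finset V) (hSne : S.Nonempty)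
    (p : ℝ) (hp0 : 0 < p) (hp1 : p ≤ 1) (x : V)
    (hx : x ∉ convexHull ℝ (S : Set V)) :
    ∃ d ∈ S, p • x + (1 - p) • d ∉ convexHull ℝ (S : Set V) := by
  obtain ⟨f, u, hfu, hux⟩ := geometric_hahn_banach_closed_point (convex_convexHull ℝ (S : Set V))
    (S.finite_toSet.isClosed_convexHull ℝ) hx
  obtain ⟨d, hd, hmax⟩ := S.exists_max_image f hSne
  refine ⟨d, hd, fun hmem => ?_⟩
  have hle : convexHull ℝ (S : Set V) ⊆ {y | f y ≤ f d} :=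
    convexHull_min hmax (convex_halfSpace_le f.toLinearMap.isLinear _)
  have hmix : f (p • x + (1 - p) • d) ≤ f d := hle hmem
  have hdx : f d < f x := (hfu d (subset_convexHull ℝ _ hd)).trans hux
  simp only [map_add, map_smul, smul_eq_mul] at hmix
  nlinarith [mul_pos hp0 (sub_pos.mpr hdx)]
end

section
/- (Key lemma for Proposition 3.) Let ρ be a density matrix on ℂ^{dA} ⊗ ℂ^{dB} and let (M_i)_{i∈ι}, (N_i)_{i∈ι} be finite families of dA×dA and dB×dB complex matrices with ∑_{i∈ι} M_iᴴM_i ⊗ₖ N_iᴴN_i = 1 (a separable operation). For each i set q_i := Re tr((M_iᴴM_i ⊗ₖ N_iᴴN_i)·ρ), and let ρ' := ∑_{i∈ι} (M_i ⊗ₖ N_i) ρ (M_i ⊗ₖ N_i)ᴴ. Suppose there exist POVMs (A_{i|k})_{i∈I} on ℂ^{dA} (k ∈ K) and (B_{j|l})_{j∈J} on ℂ^{dB} (l ∈ L) whose quantum behavior for ρ' does not lie in the local polytope 𝓛. Then there exists an index ι₀ ∈ ι with q_{ι₀} > 0 such that the quantum behavior of the filtered state ω_{ι₀} := (1/q_{ι₀})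 • (M_{ι₀} ⊗ₖ N_{ι₀}) ρ (M_{ι₀} ⊗ₖ N_{ι₀})ᴴ, with the same POVMs (A_{i|k}) and (B_{j|l}), does not lie in 𝓛. -/
open Kronecker Matrix
open scoped ComplexOrder

/-- A POVM: a finite family of positive semidefinite matrices summing to `1`. -/
def IsPOVM {d I : Type*} [Fintype d] [DecidableEq d] [Fintype I]
    (A : I → Matrix d d ℂ) : Prop :=
  (∀ i, (A i).PosSemidef) ∧ ∑ i, A i = 1

/-- The deterministic behavior associated with local response functions
`r : K → I` and `s : L → J`. -/
def detBehavior {I J K L : Type*} [DecidableEq I] [DecidableEq J]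
    (r : K → I) (s : L → J) : I × J × K × L → ℝ :=
  fun x => if x.1 = r x.2.2.1 ∧ x.2.1 = s x.2.2.2 then 1 else 0

/-- The local polytope: the convex hull of the deterministic behaviors. -/
def localPolytope (I J K L : Type*) [DecidableEq I] [DecidableEq J] :
    Set (I × J × K × L → ℝ) :=
  convexHull ℝ {b | ∃ r s, b = detBehavior r s}

/-- The quantum behavior of a bipartite state `σ` with measurement families
`A k` (on the first factor) and `B l` (on the second factor). -/
noncomputable def qBehavior {dA dB I J K L : Type*} [Fintype dA] [Fintype dB]
    (σ : Matrix (dA × dB) (dA × dB) ℂ)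
    (A : K → I → Matrix dA dA ℂ) (B : L → J → Matrix dB dB ℂ) :
    I × J × K × L → ℝ :=
  fun x => ((σ * (A x.2.2.1 x.1 ⊗ₖ B x.2.2.2 x.2.1)).trace).re

section Behavior

variable {dA dB I J K L : Type*} [Fintype dA] [Fintype dB]
  (A : K → I → Matrix dA dA ℂ) (B : L → J → Matrix dB dB ℂ)

lemma qBehavior_sum {ι : Type*} (s : Finset ι) (σ : ι → Matrix (dA × dB) (dA × dB) ℂ) :
    qBehavior (∑ i ∈ s, σ i) A B = ∑ i ∈ s, qBehavior (σ i) A B := by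
  ext x
  simp [qBehavior, Finset.sum_mul, trace_sum]

lemma qBehavior_ofReal_smul (c : ℝ) (σ : Matrix (dA × dB) (dA × dB) ℂ) :
    qBehavior ((c : ℂ) • σ) A B = c • qBehavior σ A B := by
  ext x
  simp [qBehavior]

end Behavior

lemma trace_kronecker_conj {dA dB : Type*} [Fintype dA] [Fintype dB]
    (M : Matrix dA dA ℂ) (N : Matrix dB dB ℂ) (ρ : Matrix (dA × dB) (dA × dB) ℂ) :
    ((M ⊗ₖ N) * ρ * (M ⊗ₖ N)ᴴ).trace = (((Mᴴ * M) ⊗ₖ (Nᴴ * N)) * ρ).trace := by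
  rw [trace_mul_comm, ← Matrix.mul_assoc, conjTranspose_kronecker, mul_kronecker_mul]

/-- Key lemma for Proposition 3: if the output `ρ' = ∑ᵢ (Mᵢ⊗Nᵢ) ρ (Mᵢ⊗Nᵢ)ᴴ` of
a separable operation has a nonlocal behavior for some measurements, then one
of the filtered states `ωᵢ = qᵢ⁻¹ (Mᵢ⊗Nᵢ) ρ (Mᵢ⊗Nᵢ)ᴴ`, with `qᵢ > 0`, has a
nonlocal behavior for the same measurements. -/
theorem exists_filtered_nonlocal_of_separable_output_nonlocal {dA dB : ℕ}
    (ρ : Matrix (Fin dA × Fin dB) (Fin dA × Fin dB) ℂ)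
    (hρ : ρ.PosSemidef) (hρtr : ρ.trace = 1)
    {ι : Type*} [Fintype ι]
    (Ms : ι → Matrix (Fin dA) (Fin dA) ℂ)
    (Ns : ι → Matrix (Fin dB) (Fin dB) ℂ)
    (hsep : ∑ i, ((Ms i)ᴴ * Ms i) ⊗ₖ ((Ns i)ᴴ * Ns i) = 1)
    (q : ι → ℝ)
    (hq : ∀ i, q i = (((((Ms i)ᴴ * Ms i) ⊗ₖ ((Ns i)ᴴ * Ns i)) * ρ).trace).re)
    {I J K L : Type*}
    [Fintype I] [Nonempty I] [DecidableEq I]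
    [Fintype J] [Nonempty J] [DecidableEq J]
    [Fintype K] [Nonempty K] [Fintype L] [Nonempty L]
    (A : K → I → Matrix (Fin dA) (Fin dA) ℂ)
    (B : L → J → Matrix (Fin dB) (Fin dB) ℂ)
    (hA : ∀ k, IsPOVM (A k)) (hB : ∀ l, IsPOVM (B l))
    (hnl : qBehavior (∑ i, (Ms i ⊗ₖ Ns i) * ρ * (Ms i ⊗ₖ Ns i)ᴴ) A B
      ∉ localPolytope I J K L) :
    ∃ i0, 0 < q i0 ∧
      qBehavior (((q i0 : ℂ))⁻¹ • ((Ms i0 ⊗ₖ Ns i0) * ρ * (Ms i0 ⊗ₖ Ns i0)ᴴ))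
        A B ∉ localPolytope I J K L := by
  set T := fun i => (Ms i ⊗ₖ Ns i) * ρ * (Ms i ⊗ₖ Ns i)ᴴ with hT
  have hTpos i : (T i).PosSemidef := hρ.mul_mul_conjTranspose_same _
  have hTtr i : (T i).trace = q i := by
    have hre : (T i).trace.re = q i := by rw [hq, hT, trace_kronecker_conj]
    rw [← hre]
    exact Complex.eq_re_of_ofReal_le (r := 0) (by simpa using (hTpos i).trace_nonneg)
  have hq_nonneg i : 0 ≤ q i := by
    have h := (hTpos i).trace_nonneg
    rwa [hTtr, Complex.zero_le_real] at h
  have hq_sum : ∑ i, q i = 1 := by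
    simp_rw [hq]
    rw [← Complex.re_sum, ← trace_sum, ← Finset.sum_mul, hsep, Matrix.one_mul, hρtr,
      Complex.one_re]
  have hT_zero i (hi : q i = 0) : T i = 0 :=
    (hTpos i).trace_eq_zero_iff.mp (by rw [hTtr, hi, Complex.ofReal_zero])
  have hT_smul i : T i = (q i : ℂ) • ((q i : ℂ)⁻¹ • T i) := by
    by_cases hi : q i = 0
    · simp [hT_zero i hi]
    · rw [smul_inv_smul₀ (Complex.ofReal_ne_zero.mpr hi)]
  have hq_pos {i} (hi : q i ≠ 0) : 0 < q i := (hq_nonneg i).lt_of_ne' hi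
  by_contra! hloc
  apply hnl
  rw [qBehavior_sum, ← Finset.sum_filter_of_ne (p := fun i => q i ≠ 0)]
  · rw [Finset.sum_congr rfl fun i _ => (congrArg (qBehavior · A B) (hT_smul i)).trans
      (qBehavior_ofReal_smul A B _ _)]
    refine (convex_convexHull ℝ _).sum_mem (fun i _ => hq_nonneg i)
      (by rw [Finset.sum_filter_ne_zero, hq_sum]) fun i hi => ?_
    exact hloc i (hq_pos (Finset.mem_filter.mp hi).2)
  · intro i _ hne hi
    apply hne
    change qBehavior (T i) A B = 0
    rw [hT_zero i hi]
    ext x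
    simp [qBehavior]
end
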